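/- arXiv:1906.12147 — 3 statements merged into one kernel-verified Lean document; each statement's English description precedes it below -/
import Mathlib

section
/- For every integer n ≥ 1 and every real α with 0 < α < 1, the (n+1)×(n+1) matrix G of the truncated geometric mechanism is invertible (its determinant is nonzero). -/
/-- The truncated geometric mechanism on `{0,...,n}`. -/
noncomputable def truncGeom (n : ℕ) (α : ℝ) : Matrix (Fin (n + 1)) (Fin (n + 1)) ℝ :=
  fun i j =>
    if (j : ℕ) = 0 then α ^ (i : ℕ) / (1 + α)
    else if (j : ℕ) = n then α ^ (n - (i : ℕ)) / (1 + α)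
    else ((1 - α) / (1 + α)) * α ^ ((i : ℤ) - (j : ℤ)).natAbs

/-- For every `n ≥ 1` and `0 < α < 1`, the truncated geometric mechanism matrix is
invertible: its determinant is nonzero. -/
theorem truncGeom_invertible (n : ℕ) (hn : 1 ≤ n) (α : ℝ) (hα0 : 0 < α) (hα1 : α < 1) :
    (truncGeom n α).det ≠ 0 ∧ IsUnit (truncGeom n α) := by
  have hdet : (truncGeom n α).det ≠ 0 := by
    have h1 : (0 : ℝ) < 1 + α := by linarith
    have h2 : (0 : ℝ) < 1 - α := by linarith
    set A := truncGeom n α with hA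
    let B : Matrix (Fin (n + 1)) (Fin (n + 1)) ℝ := fun i j =>
      Fin.cases (A 0 j) (fun k => A k.succ j - α * A k.castSucc j) i
    have hAB : A.det = B.det := by
      refine Matrix.det_eq_of_forall_row_eq_smul_add_pred (fun _ => α) (fun j => rfl) ?_
      intro i j
      change A i.succ j = (A i.succ j - α * A i.castSucc j) + α * A i.castSucc j
      ring
    have htri : B.BlockTriangular id := by
      intro i j hij
      simp only [id] at hij
      induction i using Fin.cases with
      | zero => exact absurd hij (by simp)
      | succ k =>
        change A k.succ j - α * A k.castSucc j = 0
        have hjk : (j : ℕ) ≤ k := by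
          have := Fin.lt_def.mp hij
          simp at this
          omega
        have hk := k.isLt
        have e : (((k : ℕ) + 1 : ℤ) - (j : ℕ)).natAbs = (((k : ℕ) : ℤ) - (j : ℕ)).natAbs + 1 := by
          omega
        simp only [hA, truncGeom, Fin.val_succ, Fin.val_castSucc]
        push_cast
        rw [e]
        split_ifs with c1 c2
        · ring
        · omega
        · ring
    rw [hAB, Matrix.det_of_isUpperTriangular htri]
    refine Finset.prod_ne_zero_iff.mpr ?_
    intro i _
    induction i using Fin.cases with
    | zero =>
      change A 0 0 ≠ 0
      simp [hA, truncGeom, h1.ne']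
    | succ k =>
      change A k.succ k.succ - α * A k.castSucc k.succ ≠ 0
      have hk := k.isLt
      have e : (((k : ℕ) : ℤ) - ((k : ℕ) + 1 : ℤ)).natAbs = 1 := by omega
      have h3 : 0 < 1 - α * α := by nlinarith
      simp only [hA, truncGeom, Fin.val_succ, Fin.val_castSucc]
      push_cast
      rw [e]
      split_ifs with c
      · have e1 : n - ((k : ℕ) + 1) = 0 := by omega
        have e2 : n - (k : ℕ) = 1 := by omega
        rw [e1, e2]
        have : α ^ 0 / (1 + α) - α * (α ^ 1 / (1 + α)) = (1 - α * α) / (1 + α) := by ring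
        rw [this]
        positivity
      · have : (1 - α) / (1 + α) * α ^ (((k : ℕ) + 1 : ℤ) - ((k : ℕ) + 1 : ℤ)).natAbs
            - α * ((1 - α) / (1 + α) * α ^ 1) = (1 - α) / (1 + α) * (1 - α * α) := by
          rw [sub_self, Int.natAbs_zero]
          ring
        rw [this]
        positivity
  exact ⟨hdet, (Matrix.isUnit_iff_isUnit_det _).mpr hdet.isUnit⟩
end

section
/- One step of the IBU never decreases the log-likelihood: if p is a probability distribution on {0,...,n} with full support, q is a probability distribution on {0,...,n}, and p' is the IBU update of p, then ∑_{j : q_j>0} q_j·log((p'G)_j) ≥ ∑_{j : q_j>0} q_j·log((pG)_j). -/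
open Finset in
theorem IBU_aux {ι : Type*} [Fintype ι] (G : ι → ι → ℝ) (hG : ∀ i j, 0 < G i j)
    (p q : ι → ℝ)
    (hp0 : ∀ i, 0 < p i) (hp1 : ∑ i, p i = 1)
    (hq0 : ∀ j, 0 ≤ q j) (hq1 : ∑ j, q j = 1)
    (p' : ι → ℝ)
    (hp' : ∀ i, p' i = ∑ j, q j * (p i * G i j / ∑ h, p h * G h j)) :
    (∑ j, q j * Real.log (∑ h, p h * G h j))
      ≤ ∑ j, q j * Real.log (∑ h, p' h * G h j) := by
  have hne : (univ : Finset ι).Nonempty := by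
    by_contra h
    rw [not_nonempty_iff_eq_empty] at h
    simp [h] at hq1
  have hS : ∀ j, 0 < ∑ h, p h * G h j := fun j =>
    sum_pos (fun i _ => mul_pos (hp0 i) (hG i j)) hne
  obtain ⟨j0, -, hj0⟩ : ∃ j ∈ univ, 0 < q j := by
    by_contra! h
    have := sum_nonpos h
    linarith
  have hw : ∀ i j, 0 < p i * G i j / ∑ h, p h * G h j := fun i j =>
    div_pos (mul_pos (hp0 i) (hG i j)) (hS j)
  have hp'0 : ∀ i, 0 < p' i := fun i => by
    rw [hp']
    exact sum_pos' (fun j _ => mul_nonneg (hq0 j) (hw i j).le)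
      ⟨j0, mem_univ _, mul_pos hj0 (hw i j0)⟩
  have hw1 : ∀ j, ∑ i, p i * G i j / ∑ h, p h * G h j = 1 := fun j => by
    rw [← sum_div, div_self (hS j).ne']
  have hp'1 : ∑ i, p' i = 1 := by
    simp_rw [hp']
    rw [sum_comm]
    simp_rw [← mul_sum, hw1, mul_one, hq1]
  have hS' : ∀ j, 0 < ∑ h, p' h * G h j := fun j =>
    sum_pos (fun i _ => mul_pos (hp'0 i) (hG i j)) hne
  have key : ∀ j, ∑ i, (p i * G i j / ∑ h, p h * G h j) * Real.log (p' i / p i)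
      ≤ Real.log (∑ h, p' h * G h j) - Real.log (∑ h, p h * G h j) := fun j => by
    have h := strictConcaveOn_log_Ioi.concaveOn.le_map_sum (t := univ)
      (w := fun i => p i * G i j / ∑ h, p h * G h j) (p := fun i => p' i / p i)
      (fun i _ => (hw i j).le) (hw1 j) (fun i _ => div_pos (hp'0 i) (hp0 i))
    simp only [smul_eq_mul] at h
    rw [← Real.log_div (hS' j).ne' (hS j).ne']
    refine h.trans_eq ?_
    congr 1
    rw [sum_div]
    refine sum_congr rfl fun i _ => ?_
    have := (hp0 i).ne'
    have := (hS j).ne'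
    field_simp
  have h1 : ∑ i, p' i * Real.log (p' i / p i) ≤
      ∑ j, q j * (Real.log (∑ h, p' h * G h j) - Real.log (∑ h, p h * G h j)) := by
    calc ∑ i, p' i * Real.log (p' i / p i)
        = ∑ i, ∑ j, q j * (p i * G i j / ∑ h, p h * G h j) * Real.log (p' i / p i) := by
          refine sum_congr rfl fun i _ => ?_
          rw [← sum_mul, ← hp']
      _ = ∑ j, q j * ∑ i, (p i * G i j / ∑ h, p h * G h j) * Real.log (p' i / p i) := by
          rw [sum_comm]
          simp_rw [mul_sum, mul_assoc]
      _ ≤ _ := sum_le_sum fun j _ => mul_le_mul_of_nonneg_left (key j) (hq0 j)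
  have h2 : ∑ i, (p' i - p i) ≤ ∑ i, p' i * Real.log (p' i / p i) := by
    refine sum_le_sum fun i _ => ?_
    have h := Real.one_sub_inv_le_log_of_pos (div_pos (hp'0 i) (hp0 i))
    have h := mul_le_mul_of_nonneg_left h (hp'0 i).le
    refine le_trans (le_of_eq ?_) h
    have := (hp'0 i).ne'
    field_simp
  rw [sum_sub_distrib, hp1, hp'1] at h2
  simp_rw [mul_sub] at h1
  rw [sum_sub_distrib] at h1
  linarith

open Finset in
/-- One step of the IBU never decreases the log-likelihood: if `p` is a full-support
probability distribution on `{0,...,n}`, `q` is a probability distribution, and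
`p'_i = ∑_j q_j · p_i·G_{ij}/(pG)_j`, then
`∑_{j : q_j>0} q_j·log((p'G)_j) ≥ ∑_{j : q_j>0} q_j·log((pG)_j)`. -/
theorem IBU_step_increases_loglikelihood (n : ℕ) (hn : 1 ≤ n)
    (α : ℝ) (hα0 : 0 < α) (hα1 : α < 1)
    (p q : Fin (n + 1) → ℝ)
    (hp0 : ∀ i, 0 < p i) (hp1 : ∑ i, p i = 1)
    (hq0 : ∀ j, 0 ≤ q j) (hq1 : ∑ j, q j = 1)
    (p' : Fin (n + 1) → ℝ)
    (hp' : ∀ i, p' i =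
      ∑ j, q j * (p i * truncGeom n α i j / ∑ h, p h * truncGeom n α h j)) :
    (∑ j ∈ univ.filter (fun j => 0 < q j), q j * Real.log (∑ h, p h * truncGeom n α h j))
      ≤ ∑ j ∈ univ.filter (fun j => 0 < q j),
          q j * Real.log (∑ h, p' h * truncGeom n α h j) := by
  have hG : ∀ i j, 0 < truncGeom n α i j := by
    intro i j
    have : 0 < 1 - α := by linarith
    unfold truncGeom
    split_ifs <;> positivity
  have hf : ∀ f : Fin (n + 1) → ℝ,
      ∑ j ∈ univ.filter (fun j => 0 < q j), q j * f j = ∑ j, q j * f j := fun f =>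
    sum_filter_of_ne fun j _ h => lt_of_le_of_ne (hq0 j) (Ne.symm (left_ne_zero_of_mul h))
  rw [hf (fun j => Real.log (∑ h, p h * truncGeom n α h j)),
    hf (fun j => Real.log (∑ h, p' h * truncGeom n α h j))]
  exact IBU_aux (truncGeom n α) hG p q hp0 hp1 hq0 hq1 p' hp'
end

section
/- Calibration of the geometric mechanism within a radius: let m ≥ 1 be an integer and ε > 0, and let G be the truncated geometric mechanism on {0,...,n} with parameter α = e^{-ε/m}. Then for all i, i', j ∈ {0,...,n} with |i - i'| ≤ m, G_{ij} ≤ e^{ε}·G_{i'j}. -/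
/-- Calibration of the geometric mechanism within a radius: for `m ≥ 1`, `ε > 0` and
`α = e^{-ε/m}`, the truncated geometric mechanism satisfies `G_{ij} ≤ e^ε·G_{i'j}`
whenever `|i - i'| ≤ m`. -/
theorem truncGeom_calibrated_radius (n m : ℕ) (hn : 1 ≤ n) (hm : 1 ≤ m)
    (ε : ℝ) (hε : 0 < ε) (α : ℝ) (hα : α = Real.exp (-(ε / m))) :
    ∀ i i' j : Fin (n + 1), |(i : ℤ) - (i' : ℤ)| ≤ (m : ℤ) →
      truncGeom n α i j ≤ Real.exp ε * truncGeom n α i' j := by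
  have h0 : 0 < α := hα ▸ Real.exp_pos _
  have hm0 : (0 : ℝ) < m := by exact_mod_cast hm
  have h1 : α ≤ 1 := by
    rw [hα]
    apply Real.exp_le_one_iff.mpr
    have : 0 < ε / m := by positivity
    linarith
  have hpow : Real.exp ε * α ^ m = 1 := by
    rw [hα, ← Real.exp_nat_mul, ← Real.exp_add, Real.exp_eq_one_iff]
    field_simp
    ring
  have key : ∀ a b : ℕ, b ≤ a + m → α ^ a ≤ Real.exp ε * α ^ b := by
    intro a b hab
    calc α ^ a = Real.exp ε * α ^ (a + m) := by
          rw [pow_add]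
          linear_combination (-α ^ a) * hpow
      _ ≤ Real.exp ε * α ^ b :=
          mul_le_mul_of_nonneg_left (pow_le_pow_of_le_one h0.le h1 hab) (Real.exp_pos _).le
  intro i i' j hij
  have hi := i.isLt
  have hi' := i'.isLt
  rw [abs_le] at hij
  unfold truncGeom
  split_ifs
  · rw [← mul_div_assoc]
    exact div_le_div_of_nonneg_right (key _ _ (by omega)) (by linarith)
  · rw [← mul_div_assoc]
    exact div_le_div_of_nonneg_right (key _ _ (by omega)) (by linarith)
  · rw [mul_left_comm]
    exact mul_le_mul_of_nonneg_left (key _ _ (by omega))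
      (div_nonneg (by linarith) (by linarith))
end
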